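/- If each factor of an aperiodic recurrent infinite binary word w has at most three abelian returns, then w is 2-balanced, i.e., for any two factors u and v of w of equal length, ||u|_1 − |v|_1| ≤ 2. -/

import Mathlib

variable {α : Type*}

/-- The factor of the infinite word `w` of length `n` starting at position `i`. -/
def factorAt (w : ℕ → α) (i n : ℕ) : List α :=
  (List.range n).map fun k => w (i + k)

/-- `u` is a factor of the infinite word `w`. -/
def IsFactor (w : ℕ → α) (u : List α) : Prop :=
  ∃ i, factorAt w i u.length = u

/-- `w` is recurrent: each of its factors occurs infinitely many times. -/
def Recurrent (w : ℕ → α) : Prop :=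
  ∀ u : List α, IsFactor w u → ∀ N : ℕ, ∃ i, N ≤ i ∧ factorAt w i u.length = u

/-- `w` is periodic: there is `T > 0` with `w (n + T) = w n` for all `n`. -/
def Periodic (w : ℕ → α) : Prop :=
  ∃ T : ℕ, 0 < T ∧ ∀ n, w (n + T) = w n

def Aperiodic (w : ℕ → α) : Prop := ¬ Periodic w

def UltimatelyPeriodic (w : ℕ → α) : Prop :=
  ∃ N T : ℕ, 0 < T ∧ ∀ n, N ≤ n → w (n + T) = w n

/-- `w` is Sturmian: aperiodic with subword complexity `n + 1`. -/
def Sturmian (w : ℕ → α) : Prop :=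
  Aperiodic w ∧ ∀ n : ℕ, {u : List α | u.length = n ∧ IsFactor w u}.ncard = n + 1

/-- Positions where `u` occurs in `w`. -/
def Occurrences (w : ℕ → α) (u : List α) : Set ℕ :=
  {i | factorAt w i u.length = u}

/-- The return words of `u` in `w`: words from one occurrence of `u` to the next. -/
def ReturnWords (w : ℕ → α) (u : List α) : Set (List α) :=
  {r | ∃ i j : ℕ, i ∈ Occurrences w u ∧ j ∈ Occurrences w u ∧ i < j ∧
    (∀ k, i < k → k < j → k ∉ Occurrences w u) ∧ r = factorAt w i (j - i)}

/-- Positions where a word abelian-equivalent to `u` occurs in `w`. -/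
def AbelianOccurrences (w : ℕ → α) (u : List α) : Set ℕ :=
  {i | List.Perm (factorAt w i u.length) u}

/-- The abelian return words of `u` in `w`. -/
def AbelianReturnWords (w : ℕ → α) (u : List α) : Set (List α) :=
  {r | ∃ i j : ℕ, i ∈ AbelianOccurrences w u ∧ j ∈ AbelianOccurrences w u ∧ i < j ∧
    (∀ k, i < k → k < j → k ∉ AbelianOccurrences w u) ∧ r = factorAt w i (j - i)}

/-- The abelian equivalence classes (as multisets) of the abelian return words of `u` in `w`. -/
def abelianReturnClasses (w : ℕ → α) (u : List α) : Set (Multiset α) :=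
  (fun r : List α => (r : Multiset α)) '' AbelianReturnWords w u

def RightSpecial (w : ℕ → α) (u : List α) : Prop :=
  ∃ a b : α, a ≠ b ∧ IsFactor w (u ++ [a]) ∧ IsFactor w (u ++ [b])

def LeftSpecial (w : ℕ → α) (u : List α) : Prop :=
  ∃ a b : α, a ≠ b ∧ IsFactor w (a :: u) ∧ IsFactor w (b :: u)

def Bispecial (w : ℕ → α) (u : List α) : Prop :=
  RightSpecial w u ∧ LeftSpecial w u

/-- A factor is singular if it is the only factor of `w` in its abelian class. -/
def Singular (w : ℕ → α) (u : List α) : Prop :=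
  ∀ v : List α, IsFactor w v → List.Perm v u → v = u

/-- `w` is an infinite concatenation of words from `S`. -/
def InfConcat (S : Set (List α)) (w : ℕ → α) : Prop :=
  ∃ f : ℕ → List α, (∀ n, f n ∈ S) ∧
    ∀ n, factorAt w (((List.range n).map fun k => (f k).length).sum) (f n).length = f n

/-- A finite binary word is balanced if any two factors of equal length have numbers
of occurrences of `true` differing by at most one. -/
def BalancedList (w : List Bool) : Prop :=
  ∀ u v : List Bool, u <:+: w → v <:+: w → u.length = v.length →
    |(u.count true : ℤ) - (v.count true : ℤ)| ≤ 1

/-- The sum of the letters of a factor of length `n` at position `t`, where `A` is the sequence of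
partial sums of a word over `{0, 1}`. -/
def win (A : ℕ → ℤ) (n t : ℕ) : ℤ := A (t + n) - A t

/-- `i` and `i + d` are consecutive positions whose windows of length `n` have sum `c`. -/
def IsReturn (A : ℕ → ℤ) (n : ℕ) (c : ℤ) (i d : ℕ) : Prop :=
  0 < d ∧ win A n i = c ∧ win A n (i + d) = c ∧ ∀ k, 0 < k → k < d → win A n (i + k) ≠ c

/-- The abelian classes (length, sum) of the return words to the windows of length `n`
and sum `c`. -/
def returnClasses (A : ℕ → ℤ) (n : ℕ) (c : ℤ) : Set (ℕ × ℤ) :=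
  {p | ∃ i, IsReturn A n c i p.1 ∧ p.2 = win A p.1 i}

/-- `A` is the sequence of partial sums of an aperiodic recurrent word over `{0, 1}` with at most
three abelian returns to each factor. -/
structure FewReturns (A : ℕ → ℤ) : Prop where
  letter : ∀ t, win A 1 t = 0 ∨ win A 1 t = 1
  recur : ∀ i L N, ∃ i', N ≤ i' ∧ ∀ k ≤ L, win A k i' = win A k i
  aper : ∀ T, 0 < T → ∃ n, win A 1 (n + T) ≠ win A 1 n
  few : ∀ n c, (returnClasses A n c).encard ≤ 3

/-- Windows of length `r` have sum `lo` or `lo + 1`, while windows of length `r + 1` attain both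
sums `lo` and `lo + 2`. -/
structure Level (A : ℕ → ℤ) (r : ℕ) (lo : ℤ) : Prop where
  pos : 0 < r
  two : ∀ t, win A r t = lo ∨ win A r t = lo + 1
  low : ∃ t, win A r t = lo ∧ win A r (t + 1) = lo ∧ win A 1 t = 0
  high : ∃ t, win A r t = lo + 1 ∧ win A r (t + 1) = lo + 1 ∧ win A 1 t = 1
  bal : ∀ m ≤ r, ∀ i j, win A m i ≤ win A m j + 1

lemma win_add (A : ℕ → ℤ) (m n t : ℕ) : win A (m + n) t = win A m t + win A n (t + m) := by
  simp only [win, ← add_assoc]; ring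

lemma win_zero (A : ℕ → ℤ) (t : ℕ) : win A 0 t = 0 := by simp [win]

lemma win_succ (A : ℕ → ℤ) (n t : ℕ) :
    win A n (t + 1) = win A n t + win A 1 (t + n) - win A 1 t := by
  have h1 := win_add A n 1 t
  have h2 := win_add A 1 n t
  rw [add_comm 1 n] at h2
  linarith

lemma encard_lt_four {α : Type*} {s : Set α} (hs : s.encard ≤ 3) {a b c d : α}
    (ha : a ∈ s) (hb : b ∈ s) (hc : c ∈ s) (hd : d ∈ s) (hab : a ≠ b) (hac : a ≠ c) (had : a ≠ d)
    (hbc : b ≠ c) (hbd : b ≠ d) (hcd : c ≠ d) : False := by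
  classical
  have hsub : (({a, b, c, d} : Finset α) : Set α) ⊆ s := by
    intro x hx
    simp only [Finset.coe_insert, Finset.coe_singleton, Set.mem_insert_iff,
      Set.mem_singleton_iff] at hx
    rcases hx with rfl | rfl | rfl | rfl <;> assumption
  have hcard : ({a, b, c, d} : Finset α).card = 4 := by
    simp [hab, hac, had, hbc, hbd, hcd]
  have h := (Set.encard_le_encard hsub).trans hs
  rw [Set.encard_coe_eq_coe_finsetCard, hcard] at h
  exact absurd h (by decide)

lemma IsReturn.mem {A : ℕ → ℤ} {n : ℕ} {c : ℤ} {i d : ℕ} (h : IsReturn A n c i d) :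
    (d, win A d i) ∈ returnClasses A n c := ⟨i, h, rfl⟩

lemma isReturn_one {A : ℕ → ℤ} {n : ℕ} {c : ℤ} {i : ℕ} (h : win A n i = c)
    (h' : win A n (i + 1) = c) : IsReturn A n c i 1 :=
  ⟨one_pos, h, h', fun k h1 h2 => by omega⟩

namespace FewReturns

variable {A : ℕ → ℤ}

lemma win_bounds (hA : FewReturns A) (n t : ℕ) : 0 ≤ win A n t ∧ win A n t ≤ n := by
  induction n with
  | zero => simp [win_zero]
  | succ n ih =>
    have := win_add A n 1 t
    have := hA.letter (t + n)
    push_cast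
    omega

/-- Every sum attained by windows of length `n` at a position `i ≤ j` has a return
straddling `j`. -/
lemma exists_return_across (hA : FewReturns A) {n : ℕ} {c : ℤ} {i j : ℕ} (hi : win A n i = c)
    (hij : i ≤ j) :
    ∃ i' d, i ≤ i' ∧ i' ≤ j ∧ j < i' + d ∧ IsReturn A n c i' d := by
  classical
  obtain ⟨e, he, hw⟩ := hA.recur i n (j + 1)
  have hec : win A n e = c := (hw n le_rfl).trans hi
  let i' := Nat.findGreatest (fun t => win A n t = c) j
  have hi' : win A n i' = c := Nat.findGreatest_spec (P := fun t => win A n t = c) hij hi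
  have hle : i ≤ i' := Nat.le_findGreatest hij hi
  have hle' : i' ≤ j := Nat.findGreatest_le j
  have hex : ∃ d, 0 < d ∧ win A n (i' + d) = c :=
    ⟨e - i', by omega, by rw [Nat.add_sub_cancel' (by omega)]; exact hec⟩
  obtain ⟨hd0, hd⟩ := Nat.find_spec hex
  refine ⟨i', Nat.find hex, hle, hle', ?_, hd0, hi', hd, fun k h0 hk hc => ?_⟩
  · by_contra hlt
    have := Nat.le_findGreatest (P := fun t => win A n t = c) (not_lt.mp hlt) hd
    change _ ≤ i' at this
    omega
  · exact Nat.find_min hex hk ⟨h0, hc⟩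

lemma exists_return (hA : FewReturns A) {n : ℕ} {c : ℤ} {i : ℕ} (hi : win A n i = c) :
    ∃ d, IsReturn A n c i d := by
  obtain ⟨i', d, h1, h2, -, h⟩ := hA.exists_return_across hi le_rfl
  obtain rfl : i' = i := by omega
  exact ⟨d, h⟩

lemma not_eventually_periodic (hA : FewReturns A) {s₀ Q : ℕ} (hQ : 0 < Q)
    (h : ∀ s, s₀ ≤ s → win A 1 (s + Q) = win A 1 s) : False := by
  obtain ⟨n, hn⟩ := hA.aper Q hQ
  obtain ⟨i, hi, hw⟩ := hA.recur n (Q + 1) s₀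
  have h1 := win_add A Q 1 i
  have h2 := win_add A Q 1 n
  have h3 := hw (Q + 1) le_rfl
  have h4 := hw Q (by omega)
  have h5 := hw 1 (by omega)
  have h6 := h i hi
  exact hn (by linarith)

/-- If the window sums of some fixed length are eventually periodic, then so is the word. -/
lemma not_win_eventually_periodic (hA : FewReturns A) {r s₀ p : ℕ} (hr : 0 < r) (hp : 0 < p)
    (h : ∀ s, s₀ ≤ s → win A r (s + p) = win A r s) : False := by
  have h1 : ∀ k s, s₀ ≤ s → win A p (s + r * k) = win A p s := by
    intro k
    induction k with
    | zero => simp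
    | succ k ih =>
      intro s hs
      rw [mul_add_one, ← add_assoc, ← ih s hs]
      have h1 := win_add A p r (s + r * k)
      have h2 := win_add A r p (s + r * k)
      have h3 := h (s + r * k) (by omega)
      rw [add_comm r p] at h2
      linarith
  have h2 : ∀ k s, s₀ ≤ s → win A (r * p) (s + p * k) = win A (r * p) s := by
    intro k
    induction k with
    | zero => simp
    | succ k ih =>
      intro s hs
      rw [mul_add_one, ← add_assoc, ← ih s hs]
      have h3 := win_add A p (r * p) (s + p * k)
      have h4 := win_add A (r * p) p (s + p * k)
      have h5 := h1 p (s + p * k) (by omega)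
      rw [add_comm (r * p) p] at h4
      linarith
  refine hA.not_eventually_periodic (s₀ := s₀) (Nat.mul_pos hr hp) fun s hs => ?_
  have e1 := h2 r s hs
  have e2 := h2 r (s + 1) (by omega)
  rw [mul_comm p r] at e1 e2
  have e3 := win_succ A (r * p) s
  have e4 := win_succ A (r * p) (s + r * p)
  rw [show s + r * p + 1 = s + 1 + r * p by ring] at e4
  have := hA.letter s
  have := hA.letter (s + r * p)
  have := hA.letter (s + r * p + r * p)
  omega

/-- Arbitrarily long prefixes are followed by both letters, each infinitely often. -/
lemma exists_special (hA : FewReturns A) (M : ℕ) :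
    ∃ L, M ≤ L ∧ ∀ e : ℤ, e = 0 ∨ e = 1 → ∀ N, ∃ a, N ≤ a ∧
      (∀ k ≤ L, win A k a = win A k 0) ∧ win A 1 (a + L) = e := by
  classical
  obtain ⟨i, hi, hw⟩ := hA.recur 0 M 1
  have hex := hA.aper i hi
  let L := Nat.find hex
  have hL : win A 1 (L + i) ≠ win A 1 L := Nat.find_spec hex
  have hlt : ∀ k < L, win A 1 (k + i) = win A 1 k := fun k hk => not_not.mp (Nat.find_min hex hk)
  have hML : M ≤ L := by
    by_contra hlt'
    have h1 := win_add A L 1 i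
    have h2 := win_add A L 1 0
    have h3 := hw (L + 1) (by omega)
    have h4 := hw L (by omega)
    rw [zero_add] at h2
    rw [add_comm i L] at h1
    exact hL (by linarith)
  have hpre : ∀ k ≤ L, win A k i = win A k 0 := by
    intro k
    induction k with
    | zero => simp [win_zero]
    | succ k ih =>
      intro hk
      have h1 := win_add A k 1 i
      have h2 := win_add A k 1 0
      have h3 := hlt k (by omega)
      have h4 := ih (by omega)
      rw [zero_add] at h2
      rw [add_comm i k] at h1
      linarith
  have key : ∀ x : ℕ, (∀ k ≤ L, win A k x = win A k 0) → ∀ N, ∃ a, N ≤ a ∧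
      (∀ k ≤ L, win A k a = win A k 0) ∧ win A 1 (a + L) = win A 1 (x + L) := by
    intro x hx N
    obtain ⟨a, ha, hwa⟩ := hA.recur x (L + 1) N
    refine ⟨a, ha, fun k hk => (hwa k (by omega)).trans (hx k hk), ?_⟩
    have h1 := win_add A L 1 a
    have h2 := win_add A L 1 x
    have h3 := hwa (L + 1) le_rfl
    have h4 := hwa L (by omega)
    linarith
  refine ⟨L, hML, fun e he N => ?_⟩
  by_cases h0 : win A 1 L = e
  · obtain ⟨a, h1, h2, h3⟩ := key 0 (fun _ _ => rfl) N
    exact ⟨a, h1, h2, by rw [h3, zero_add, h0]⟩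
  · obtain ⟨a, h1, h2, h3⟩ := key i hpre N
    refine ⟨a, h1, h2, ?_⟩
    rw [h3, add_comm i L]
    have := hA.letter L
    have := hA.letter (L + i)
    omega

end FewReturns

/-- If all nontrivial returns to each of the two window sums of length `r` have the same length,
then the word is eventually periodic. -/
lemma Level.false_of_unique_returns {A : ℕ → ℤ} (hA : FewReturns A) {r : ℕ} {lo : ℤ}
    (hL : Level A r lo)
    (h : ∀ c : ℤ, c = lo ∨ c = lo + 1 → ∀ i d i' d', IsReturn A r c i d → IsReturn A r c i' d' →
      2 ≤ d → 2 ≤ d' → d = d') : False := by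
  have hup : ∃ u, win A r u = lo ∧ win A r (u + 1) = lo + 1 := by
    obtain ⟨t, ht, -⟩ := hL.low
    obtain ⟨s, hs, -⟩ := hL.high
    obtain ⟨s', hs', hw⟩ := hA.recur s r t
    by_contra! hno
    have : ∀ k, win A r (t + k) = lo := by
      intro k
      induction k with
      | zero => exact ht
      | succ k ih => exact (hL.two (t + (k + 1))).resolve_right (hno _ ih)
    have h1 := this (s' - t)
    rw [Nat.add_sub_cancel' hs', hw r le_rfl] at h1
    omega
  obtain ⟨u₀, hu₀, hu₀'⟩ := hup
  have hup_ret : ∀ u, win A r u = lo → win A r (u + 1) = lo + 1 →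
      ∃ d, 2 ≤ d ∧ IsReturn A r lo u d := by
    intro u h1 h2
    obtain ⟨d, hd⟩ := hA.exists_return h1
    refine ⟨d, ?_, hd⟩
    by_contra hlt
    obtain rfl : d = 1 := by have := hd.1; omega
    have := hd.2.2.1
    omega
  have hdown_ret : ∀ u, win A r u = lo + 1 → win A r (u + 1) = lo →
      ∃ d, 2 ≤ d ∧ IsReturn A r (lo + 1) u d := by
    intro u h1 h2
    obtain ⟨d, hd⟩ := hA.exists_return h1
    refine ⟨d, ?_, hd⟩
    by_contra hlt
    obtain rfl : d = 1 := by have := hd.1; omega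
    have := hd.2.2.1
    omega
  have hdown : ∀ u d, 2 ≤ d → IsReturn A r lo u d →
      win A r (u + (d - 1)) = lo + 1 ∧ win A r (u + (d - 1) + 1) = lo := by
    intro u d hd hret
    refine ⟨(hL.two _).resolve_left (hret.2.2.2 _ (by omega) (by omega)), ?_⟩
    rw [show u + (d - 1) + 1 = u + d by omega]
    exact hret.2.2.1
  obtain ⟨p, hp, hretp⟩ := hup_ret u₀ hu₀ hu₀'
  obtain ⟨h1, h2⟩ := hdown _ _ hp hretp
  obtain ⟨q, hq, hretq⟩ := hdown_ret _ h1 h2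
  have key : ∀ u, win A r u = lo → win A r (u + 1) = lo + 1 →
      (win A r (u + (p + q - 2)) = lo ∧ win A r (u + (p + q - 2) + 1) = lo + 1) ∧
      ∀ s ≤ p + q - 2, win A r (u + s) = if 0 < s ∧ s < p then lo + 1 else lo := by
    intro u hu hu'
    obtain ⟨d, hd, hret⟩ := hup_ret u hu hu'
    obtain rfl : d = p := h lo (.inl rfl) _ _ _ _ hret hretp hd hp
    obtain ⟨h1, h2⟩ := hdown _ _ hd hret
    obtain ⟨e, he, hret'⟩ := hdown_ret _ h1 h2
    obtain rfl : e = q := h (lo + 1) (.inr rfl) _ _ _ _ hret' hretq he hq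
    have hlow : ∀ s, d ≤ s → s ≤ d + e - 2 → win A r (u + s) = lo := by
      intro s hs hs'
      have := (hL.two (u + (d - 1) + (s - (d - 1)))).resolve_right
        (hret'.2.2.2 _ (by omega) (by omega))
      rwa [show u + (d - 1) + (s - (d - 1)) = u + s by omega] at this
    refine ⟨⟨hlow _ (by omega) le_rfl, ?_⟩, fun s hs => ?_⟩
    · rw [show u + (d + e - 2) + 1 = u + (d - 1) + e by omega]
      exact hret'.2.2.1
    · split_ifs with hc
      · exact (hL.two _).resolve_left (hret.2.2.2 s hc.1 hc.2)
      · rcases Nat.eq_zero_or_pos s with rfl | hs0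
        · exact hu
        · exact hlow s (by omega) hs
  have hall : ∀ l, win A r (u₀ + (p + q - 2) * l) = lo ∧
      win A r (u₀ + (p + q - 2) * l + 1) = lo + 1 := by
    intro l
    induction l with
    | zero => exact ⟨hu₀, hu₀'⟩
    | succ l ih =>
      rw [mul_add_one, ← add_assoc]
      exact (key _ ih.1 ih.2).1
  refine hA.not_win_eventually_periodic hL.pos (show 0 < p + q - 2 by omega) (s₀ := u₀)
    fun s hs => ?_
  have hmod := Nat.mod_lt (s - u₀) (show 0 < p + q - 2 by omega)
  have hdm := Nat.mod_add_div (s - u₀) (p + q - 2)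
  set l := (s - u₀) / (p + q - 2)
  set k := (s - u₀) % (p + q - 2)
  have e1 := (key _ (hall l).1 (hall l).2).2 k hmod.le
  have e2 := (key _ (hall (l + 1)).1 (hall (l + 1)).2).2 k hmod.le
  rw [mul_add_one] at e2
  rw [show s = u₀ + (p + q - 2) * l + k by omega, e1, ← e2]
  congr 1
  ring

/-- The window of length `L` at `a` is the prefix of length `L`. -/
def IsPrefixAt (A : ℕ → ℤ) (L a : ℕ) : Prop := ∀ k ≤ L, win A k a = win A k 0

namespace IsPrefixAt

variable {A : ℕ → ℤ} {L a N r k : ℕ}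

lemma win_eq (h : IsPrefixAt A L a) {m : ℕ} (hk : k + m ≤ L) : win A m (a + k) = win A m k := by
  have h1 := h (k + m) hk
  have h2 := h k (by omega)
  simp only [win, zero_add, ← add_assoc] at *
  linarith

lemma win_shift (h : IsPrefixAt A L a) (h' : IsPrefixAt A L (a + N)) (hk : k ≤ L) :
    win A (N + r) (a + k) = win A N a + win A r (a + N + k) := by
  have h1 := h k hk
  have h2 := h' k hk
  simp only [win, zero_add] at *
  rw [show a + k + (N + r) = a + N + k + r by ring]
  linarith

lemma win_transport (h : IsPrefixAt A L a) (h' : IsPrefixAt A L (a + N)) (hk : k + r ≤ L) :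
    win A (N + r) (a + k) = win A N a + win A r k := by
  rw [h.win_shift h' (by omega), h'.win_eq hk]

/-- A return inside the prefix occurs as a return to windows of length `N + r`. -/
lemma mem_returnClasses (h : IsPrefixAt A L a) (h' : IsPrefixAt A L (a + N)) {c : ℤ} {i d : ℕ}
    (hret : IsReturn A r c i d) (hk : i + d + r ≤ L) :
    (d, win A d i) ∈ returnClasses A (N + r) (win A N a + c) := by
  refine ⟨a + i, ⟨hret.1, ?_, ?_, fun k h1 h2 => ?_⟩, (h.win_eq (by omega)).symm⟩
  · rw [h.win_transport h' (by omega), hret.2.1]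
  · rw [add_assoc, h.win_transport h' (by omega), hret.2.2.1]
  · rw [add_assoc, h.win_transport h' (by omega)]
    have := hret.2.2.2 k h1 h2
    omega

end IsPrefixAt

namespace FewReturns

variable {A : ℕ → ℤ}

/-- Two occurrences of a long prefix, followed by given letters. -/
lemma exists_twins (hA : FewReturns A) {e e' : ℤ} (he : e = 0 ∨ e = 1) (he' : e' = 0 ∨ e' = 1)
    (M : ℕ) :
    ∃ L a N, M ≤ L ∧ IsPrefixAt A L a ∧ IsPrefixAt A L (a + N) ∧
      win A 1 (a + L) = e ∧ win A 1 (a + N + L) = e' := by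
  obtain ⟨L, hL, h⟩ := hA.exists_special M
  obtain ⟨a, -, ha, hae⟩ := h e he 0
  obtain ⟨b, hab, hb, hbe⟩ := h e' he' a
  refine ⟨L, a, b - a, hL, ha, ?_, hae, ?_⟩ <;> rw [Nat.add_sub_cancel' hab] <;> assumption

/-- A return whose windows exceed `c` in between leaves upwards. -/
lemma letter_of_exceeds (hA : FewReturns A) {n : ℕ} {c : ℤ} {i d k : ℕ} (h : IsReturn A n c i d)
    (h0 : 0 < k)
    (hk : k < d) (hc : c < win A n (i + k)) : win A 1 i = 0 := by
  have h1 : c < win A n (i + 1) := by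
    induction k with
    | zero => rw [add_zero, h.2.1] at hc; omega
    | succ k ih =>
      rcases Nat.eq_zero_or_pos k with rfl | hk0
      · exact hc
      refine ih hk0 (by omega) ?_
      have h2 := h.2.2.2 k hk0 (by omega)
      have h3 := win_succ A n (i + k)
      have := hA.letter (i + k)
      have := hA.letter (i + k + n)
      rw [← add_assoc] at hc
      omega
  have h2 := win_succ A n i
  have := h.2.1
  have := hA.letter i
  have := hA.letter (i + n)
  omega

lemma win_le_of_two_zeros (hA : FewReturns A) {i j d : ℕ} (hij : i < j) (hj : j < i + d)
    (hi : win A 1 i = 0)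
    (hj' : win A 1 j = 0) : win A d i ≤ d - 2 := by
  obtain ⟨k, rfl⟩ := Nat.exists_eq_add_of_lt hij
  obtain ⟨m, rfl⟩ : ∃ m, d = 1 + k + 1 + m := ⟨d - (k + 2), by omega⟩
  rw [win_add, win_add, win_add]
  have h1 := (hA.win_bounds k (i + 1)).2
  have h2 := (hA.win_bounds m (i + (1 + k + 1))).2
  rw [show i + (1 + k) = i + k + 1 by ring]
  push_cast
  linarith

/-- If the letter after the prefix changes from `0` to `1`, then a window with the larger sum at
the second occurrence forces a return with at least two zeros. -/
lemma exists_return_two_zeros (hA : FewReturns A) {r : ℕ} {lo : ℤ} {L a N t : ℕ}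
    (h : IsPrefixAt A L a)
    (h' : IsPrefixAt A L (a + N)) (ha : win A 1 (a + L) = 0)
    (hhi : win A r (a + N + L) = lo + 1) (ht : win A r t = lo) (htL : t + r ≤ L) :
    ∃ i d, IsReturn A (N + r) (win A N a + lo) i d ∧ win A d i ≤ d - 2 := by
  obtain ⟨i, d, h1, h2, h3, hret⟩ := hA.exists_return_across (n := N + r) (i := a + t)
    (j := a + L) (by rw [h.win_transport h' htL, ht]) (by omega)
  have hTL := h.win_shift (r := r) h' le_rfl
  have hne : i ≠ a + L := by
    rintro rfl
    have := hret.2.1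
    omega
  obtain ⟨k, hk⟩ := Nat.exists_eq_add_of_le h2
  refine ⟨i, d, hret, hA.win_le_of_two_zeros (by omega) h3 ?_ ha⟩
  exact hA.letter_of_exceeds hret (k := k) (by omega) (by omega) (by rw [← hk]; omega)

/-- If both one-letter returns occur then all other returns are abelian equivalent. -/
lemma eq_of_letters_mem (hA : FewReturns A) {n : ℕ} {c : ℤ} (h0 : (1, 0) ∈ returnClasses A n c)
    (h1 : (1, 1) ∈ returnClasses A n c) {x y : ℕ × ℤ} (hx : x ∈ returnClasses A n c)
    (hy : y ∈ returnClasses A n c) (hx2 : 2 ≤ x.1) (hy2 : 2 ≤ y.1) : x = y := by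
  by_contra hne
  refine encard_lt_four (hA.few n c) h0 h1 hx hy (by simp) ?_ ?_ ?_ ?_ hne <;>
  · rintro rfl
    simp at hx2 hy2

end FewReturns

/-- Partial sums of the complementary word. -/
def complement (A : ℕ → ℤ) (t : ℕ) : ℤ := t - A t

lemma win_complement (A : ℕ → ℤ) (n t : ℕ) : win (complement A) n t = n - win A n t := by
  simp only [win, complement]
  push_cast
  ring

lemma isReturn_complement {A : ℕ → ℤ} {n : ℕ} {c : ℤ} {i d : ℕ} :
    IsReturn (complement A) n c i d ↔ IsReturn A n (n - c) i d := by
  have key : ∀ x : ℤ, n - x = c ↔ x = n - c := fun x => by omega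
  simp only [IsReturn, win_complement, key, ne_eq]

lemma FewReturns.complement {A : ℕ → ℤ} (hA : FewReturns A) : FewReturns (complement A) where
  letter t := by
    have := hA.letter t
    rw [win_complement]
    push_cast
    omega
  recur i L N := by
    obtain ⟨i', h, h'⟩ := hA.recur i L N
    exact ⟨i', h, fun k hk => by rw [win_complement, win_complement, h' k hk]⟩
  aper T hT := by
    obtain ⟨n, hn⟩ := hA.aper T hT
    refine ⟨n, ?_⟩
    rw [win_complement, win_complement]
    omega
  few n c := by
    refine le_trans ?_ (hA.few n (n - c))
    refine (Set.encard_le_encard ?_).trans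
      (Set.encard_image_le (fun p : ℕ × ℤ => (p.1, (p.1 : ℤ) - p.2)) _)
    rintro ⟨d, x⟩ ⟨i, hret, hx⟩
    refine ⟨_, (isReturn_complement.mp hret).mem, ?_⟩
    simp only [win_complement] at hx ⊢
    rw [hx]

namespace Level

variable {A : ℕ → ℤ} {r : ℕ} {lo : ℤ}

lemma complement (h : Level A r lo) : Level (complement A) r (r - lo - 1) where
  pos := h.pos
  two t := by
    have := h.two t
    rw [win_complement]
    omega
  low := by
    obtain ⟨t, h1, h2, h3⟩ := h.high
    refine ⟨t, ?_, ?_, ?_⟩ <;> rw [win_complement] <;> push_cast <;> omega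
  high := by
    obtain ⟨t, h1, h2, h3⟩ := h.low
    refine ⟨t, ?_, ?_, ?_⟩ <;> rw [win_complement] <;> push_cast <;> omega
  bal m hm i j := by
    have := h.bal m hm j i
    rw [win_complement, win_complement]
    omega

lemma mem_low (h : Level A r lo) : (1, 0) ∈ returnClasses A r lo := by
  obtain ⟨t, h1, h2, h3⟩ := h.low
  exact ⟨t, isReturn_one h1 h2, h3.symm⟩

lemma mem_high (h : Level A r lo) : (1, 1) ∈ returnClasses A r (lo + 1) := by
  obtain ⟨t, h1, h2, h3⟩ := h.high
  exact ⟨t, isReturn_one h1 h2, h3.symm⟩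

/-- Case where both window sums have both one-letter returns. -/
lemma false_of_letters (hA : FewReturns A) (h : Level A r lo) (h0 : (1, 1) ∈ returnClasses A r lo)
    (h1 : (1, 0) ∈ returnClasses A r (lo + 1)) : False := by
  refine h.false_of_unique_returns hA ?_
  rintro c (rfl | rfl) i d i' d' hr hr' hd hd'
  · exact congrArg Prod.fst (hA.eq_of_letters_mem h.mem_low h0 hr.mem hr'.mem hd hd')
  · exact congrArg Prod.fst (hA.eq_of_letters_mem h1 h.mem_high hr.mem hr'.mem hd hd')

end Level

lemma win_of_ones {A : ℕ → ℤ} {m t : ℕ} (h : ∀ k < m, win A 1 (t + k) = 1) : win A m t = m := by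
  induction m with
  | zero => simp [win_zero]
  | succ m ih =>
    rw [win_add, ih fun k hk => h k (by omega), h m (by omega)]
    push_cast
    ring

namespace Level

variable {A : ℕ → ℤ} {r : ℕ} {lo : ℤ}

/-- A nontrivial return to the lower sum is a zero followed by ones, if windows with the larger
sum always start with `1`. -/
lemma win_return (hA : FewReturns A) (h : Level A r lo)
    (hb : ∀ t, win A r t = lo + 1 → win A 1 t = 1) {i d : ℕ}
    (hret : IsReturn A r lo i d) (hd : 2 ≤ d) : win A d i = d - 1 := by
  obtain ⟨m, rfl⟩ : ∃ m, d = 1 + m := ⟨d - 1, by omega⟩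
  have hhi : ∀ k, 0 < k → k < 1 + m → win A r (i + k) = lo + 1 :=
    fun k h1 h2 => (h.two _).resolve_left (hret.2.2.2 k h1 h2)
  have h0 : win A 1 i = 0 :=
    hA.letter_of_exceeds hret one_pos (by omega) (by rw [hhi 1 one_pos (by omega)]; omega)
  rw [win_add, h0, win_of_ones fun k hk => hb _
    (by rw [add_assoc]; exact hhi _ (by omega) (by omega))]
  push_cast
  ring

lemma unique_low_returns (hA : FewReturns A) (h : Level A r lo)
    (hb : ∀ t, win A 1 t = win A r t - lo) {i d i' d' : ℕ} (hr : IsReturn A r lo i d)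
    (hr' : IsReturn A r lo i' d') (hd : 2 ≤ d) (hd' : 2 ≤ d') : d = d' := by
  by_contra hne
  obtain ⟨t, h1, h2, h3⟩ := h.low
  obtain ⟨L, a, N, hL, ha, hb', ha0, hb1⟩ := hA.exists_twins (.inl rfl) (.inr rfl)
    (i + d + r + (i' + d' + r) + (t + 1 + r))
  have hR := hb (a + N + L)
  obtain ⟨j, e, hret, he⟩ := hA.exists_return_two_zeros (r := r) (lo := lo) ha hb' ha0 (by omega)
    h1 (by omega)
  have hb1 : ∀ t, win A r t = lo + 1 → win A 1 t = 1 := fun t ht => by rw [hb, ht]; ring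
  have e1 := h.win_return hA hb1 hr hd
  have e2 := h.win_return hA hb1 hr' hd'
  refine encard_lt_four (hA.few (N + r) (win A N a + lo))
    (ha.mem_returnClasses hb' (isReturn_one h1 h2) (by omega))
    (ha.mem_returnClasses hb' hr (by omega)) (ha.mem_returnClasses hb' hr' (by omega)) hret.mem
    ?_ ?_ ?_ ?_ ?_ ?_ <;>
  · simp only [ne_eq, Prod.mk.injEq, not_and]
    omega

/-- Case where the first letter of a window is determined by its sum. -/
lemma false_of_letter_eq (hA : FewReturns A) (h : Level A r lo)
    (hb : ∀ t, win A 1 t = win A r t - lo) : False := by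
  refine h.false_of_unique_returns hA ?_
  rintro c (rfl | rfl) i d i' d' hr hr' hd hd'
  · exact h.unique_low_returns hA hb hr hr' hd hd'
  · have key : (r : ℤ) - (r - lo - 1) = lo + 1 := by ring
    refine h.complement.unique_low_returns hA.complement (fun t => ?_)
      (isReturn_complement.mpr (by rwa [key])) (isReturn_complement.mpr (by rwa [key])) hd hd'
    rw [win_complement, win_complement, hb]
    push_cast
    ring

end Level

lemma FewReturns.letter_of_win_eq {A : ℕ → ℤ} (hA : FewReturns A) {m t k : ℕ}
    (h : win A m t = m) (hk : k < m) : win A 1 (t + k) = 1 := by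
  obtain ⟨n, rfl⟩ : ∃ n, m = k + 1 + n := ⟨m - (k + 1), by omega⟩
  rw [win_add, win_add] at h
  have := (hA.win_bounds k t).2
  have := (hA.win_bounds n (t + (k + 1))).2
  have := hA.letter (t + k)
  push_cast at h
  omega

namespace Level

variable {A : ℕ → ℤ} {r : ℕ} {lo : ℤ}

/-- If the letter after the prefix changes from `0` to `1`, then the second occurrence of the
prefix is followed by a run of `q` ones. -/
lemma run_after (hA : FewReturns A) (h : Level A r lo)
    (hb : ∀ t, win A r t = lo + 1 → win A 1 t = 1) {L a N q t : ℕ} (ha : IsPrefixAt A L a)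
    (ha' : IsPrefixAt A L (a + N))
    (h0 : win A 1 (a + L) = 0) (h1 : win A 1 (a + N + L) = 1)
    (hq : ∀ i d, IsReturn A r lo i d → 2 ≤ d → d = q + 1)
    (hcls : ∀ x ∈ returnClasses A (N + r) (win A N a + lo),
      x = (1, 0) ∨ x = (1, 1) ∨ x = (q + 1, (q : ℤ)))
    (ht : win A r t = lo) (htL : t + r ≤ L) :
    ∀ k < q, win A 1 (a + N + L + k) = 1 := by
  have hR0 : win A r (a + N + L) = lo := by
    refine (h.two _).resolve_right fun hhi => ?_
    obtain ⟨i, d, hret, hd⟩ := hA.exists_return_two_zeros ha ha' h0 hhi ht htL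
    have := hcls _ hret.mem
    simp only [Prod.mk.injEq] at this
    omega
  have hT0 : win A (N + r) (a + L) = win A N a + lo := by rw [ha.win_shift ha' le_rfl, hR0]
  have hs := win_succ A r (a + N + L)
  have hsT := win_succ A (N + r) (a + L)
  rw [show a + L + (N + r) = a + N + L + r by ring] at hsT
  have hR1 : win A r (a + N + L + 1) = lo := by
    have := h.two (a + N + L + 1)
    have := hA.letter (a + N + L + r)
    omega
  obtain ⟨e, he⟩ := hA.exists_return hT0
  have he2 : e ≠ 1 := by
    rintro rfl
    have := he.2.2.1
    omega
  have hcl := hcls _ he.mem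
  simp only [Prod.mk.injEq] at hcl
  have he' : e = q + 1 ∧ win A e (a + L) = q := by omega
  obtain ⟨rfl, hw⟩ := he'
  rw [add_comm q 1, win_add, h0, zero_add] at hw
  have hones : ∀ k < q, win A 1 (a + L + 1 + k) = 1 := fun k hk => hA.letter_of_win_eq hw hk
  have hT : ∀ k < q, win A (N + r) (a + L + 1 + k) = win A N a + lo + 1 := by
    intro k hk
    induction k with
    | zero => rw [add_zero]; omega
    | succ k ih =>
      have h1 := ih (by omega)
      have h2 := win_succ A (N + r) (a + L + 1 + k)
      have h3 := hones k (by omega)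
      have h4 := hA.letter (a + L + 1 + k + (N + r))
      have h5 := he.2.2.2 (k + 2) (by omega) (by omega)
      rw [show a + L + (k + 2) = a + L + 1 + k + 1 by ring] at h5
      rw [← add_assoc]
      omega
  have hTq : win A (N + r) (a + L + 1 + q) = win A N a + lo := by
    rw [← he.2.2.1]
    congr 1
    ring
  have hsplit : ∀ k, win A (N + r) (a + L + 1 + k) =
      win A N (a + L + 1 + k) + win A r (a + N + L + 1 + k) := by
    intro k
    rw [win_add]
    congr 2
    ring
  have hstep : ∀ k < q, win A N (a + L + 1 + (k + 1)) =
      win A N (a + L + 1 + k) + win A 1 (a + N + L + 1 + k) - 1 := by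
    intro k hk
    have h2 := win_succ A N (a + L + 1 + k)
    rw [hones k hk] at h2
    rw [← add_assoc, h2]
    congr 3
    ring
  have hlo : ∀ k < q, win A r (a + N + L + 1 + k) = lo := by
    intro k
    induction k with
    | zero => exact fun _ => hR1
    | succ k ih =>
      intro hk
      refine (h.two _).resolve_right fun hhi => ?_
      obtain ⟨d, hd⟩ := hA.exists_return (ih (by omega))
      have hd1 : d ≠ 1 := by
        rintro rfl
        have := hd.2.2.1
        rw [add_assoc] at this
        omega
      obtain rfl := hq _ _ hd (by have := hd.1; omega)
      have hphase : ∀ m, k + 1 ≤ m → m ≤ q → win A r (a + N + L + 1 + m) = lo + 1 := by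
        intro m h1 h2
        have := (h.two _).resolve_left (hd.2.2.2 (m - k) (by omega) (by omega))
        rwa [show a + N + L + 1 + k + (m - k) = a + N + L + 1 + m by omega] at this
      have hconst : ∀ m, k + 1 ≤ m → m ≤ q → win A N (a + L + 1 + m) = win A N a := by
        intro m h1
        induction m, h1 using Nat.le_induction with
        | base =>
          intro h2
          have := hsplit (k + 1)
          rw [hT _ hk, hphase _ le_rfl h2] at this
          omega
        | succ m h1 ih =>
          intro h2
          rw [hstep m (by omega), ih (by omega), hb _ (hphase m h1 (by omega))]
          ring
      have := hsplit q
      rw [hTq, hphase q (by omega) le_rfl, hconst q (by omega) le_rfl] at this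
      omega
  have hδ : ∀ k < q, win A N (a + L + 1 + k) = win A N a + 1 := by
    intro k hk
    have := hsplit k
    rw [hT k hk, hlo k hk] at this
    omega
  intro k hk
  rcases Nat.eq_zero_or_pos k with rfl | hk0
  · exact h1
  · have h2 := hstep (k - 1) (by omega)
    rw [Nat.sub_add_cancel hk0, hδ k hk, hδ (k - 1) (by omega),
      show a + N + L + 1 + (k - 1) = a + N + L + k by omega] at h2
    omega

/-- If the letter after the prefix changes from `0` to `1`, and `1` is followed by another `1`,
then the prefix ends in a zero followed by `r - 1` ones. -/
lemma run_before (hA : FewReturns A) (h : Level A r lo)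
    (hb : ∀ t, win A r t = lo + 1 → win A 1 t = 1) {L a b q t : ℕ} (ha : IsPrefixAt A L a)
    (ha' : IsPrefixAt A L b)
    (h0 : win A 1 (a + L) = 0) (hq2 : 2 ≤ q)
    (hq : ∀ i d, IsReturn A r lo i d → 2 ≤ d → d = q + 1)
    (hrun : ∀ k < q, win A 1 (b + L + k) = 1)
    (ht : win A r t = lo) (htL : t + r < L) :
    win A 1 (L - r) = 0 ∧ (∀ k, L - r < k → k < L → win A 1 k = 1) ∧ lo + 1 = r := by
  have hr := h.pos
  have hτ : ∀ k < q, win A r (b + (L - r) + 1 + k) = lo + 1 := by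
    intro k
    induction k with
    | zero =>
      intro _
      obtain ⟨n, rfl⟩ : ∃ n, r = n + 1 := ⟨r - 1, by omega⟩
      have e1 := win_add A n 1 (a + (L - (n + 1) + 1))
      have e2 := win_add A n 1 (b + (L - (n + 1) + 1))
      have e3 := ha.win_eq (k := L - (n + 1) + 1) (m := n) (by omega)
      have e4 := ha'.win_eq (k := L - (n + 1) + 1) (m := n) (by omega)
      have e5 := hrun 0 (by omega)
      rw [show a + (L - (n + 1) + 1) + n = a + L by omega] at e1
      rw [show b + (L - (n + 1) + 1) + n = b + L + 0 by omega] at e2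
      have := h.two (a + (L - (n + 1) + 1))
      have := h.two (b + (L - (n + 1) + 1))
      rw [add_zero, add_assoc]
      omega
    | succ k ih =>
      intro hk
      have h2 := ih (by omega)
      have h3 := win_succ A r (b + (L - r) + 1 + k)
      rw [h2, hb _ h2, show b + (L - r) + 1 + k + r = b + L + (k + 1) by omega, hrun _ hk] at h3
      rw [← add_assoc, h3]
      ring
  obtain ⟨i, d, h2, h3, h4, hret⟩ := hA.exists_return_across (n := r) (i := b + t)
    (j := b + (L - r) + 1) (by rw [ha'.win_eq (by omega), ht]) (by omega)
  have hne : i ≠ b + (L - r) + 1 := by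
    rintro rfl
    have := hret.2.1
    have := hτ 0 (by omega)
    rw [add_zero] at this
    omega
  obtain rfl := hq _ _ hret (by omega)
  have hi : i = b + (L - r) := by
    by_contra hne'
    have h5 := hτ (i + (q + 1) - (b + (L - r) + 1)) (by omega)
    rw [Nat.add_sub_cancel' (by omega), hret.2.2.1] at h5
    omega
  subst hi
  have hz : win A 1 (L - r) = 0 := by
    rw [← ha'.win_eq (by omega)]
    refine hA.letter_of_exceeds hret one_pos (by omega) ?_
    have := hτ 0 (by omega)
    rw [add_zero] at this
    omega
  have hones : ∀ k, L - r < k → k < L → win A 1 k = 1 := by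
    intro k hk hkL
    refine (hA.letter k).resolve_left fun hk0 => ?_
    obtain ⟨m, rfl⟩ : ∃ m, L = k + 1 + m := ⟨L - (k + 1), by omega⟩
    have e1 := win_add A 1 (m + 1) (a + k)
    have e2 := win_add A m 1 (a + (k + 1))
    have e3 := win_add A m 2 (b + (k + 1))
    have e4 := win_add A 1 1 (b + (k + 1) + m)
    rw [one_add_one_eq_two] at e4
    have e5 := ha.win_eq (k := k) (m := 1) (by omega)
    have e6 := ha.win_eq (k := k + 1) (m := m) (by omega)
    have e7 := ha'.win_eq (k := k + 1) (m := m) (by omega)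
    have e8 := hrun 0 (by omega)
    have e9 := hrun 1 (by omega)
    have e10 := h.bal (m + 2) (by omega) (b + (k + 1)) (a + k)
    rw [show 1 + (m + 1) = m + 2 by ring, show a + k + 1 = a + (k + 1) by ring] at e1
    rw [show a + (k + 1) + m = a + (k + 1 + m) by ring] at e2
    rw [show b + (k + 1 + m) + 0 = b + (k + 1) + m by ring] at e8
    rw [show b + (k + 1 + m) + 1 = b + (k + 1) + m + 1 by ring] at e9
    omega
  refine ⟨hz, hones, ?_⟩
  rw [← hτ 0 (by omega)]
  refine win_of_ones fun k hk => ?_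
  rcases Nat.lt_or_ge (L - r + 1 + k) L with hlt | hge
  · rw [show b + (L - r) + 1 + 0 + k = b + (L - r + 1 + k) by ring, ha'.win_eq (by omega)]
    exact hones _ (by omega) hlt
  · rw [show b + (L - r) + 1 + 0 + k = b + L + 0 by omega]
    exact hrun 0 (by omega)

end Level

namespace Level

variable {A : ℕ → ℤ} {r : ℕ} {lo : ℤ}

/-- If windows of length `r` have at most one zero, then the density of ones in any factor is at
least `(r - 1) / r`, up to a bounded error. -/
lemma le_mul_win (hA : FewReturns A) (h : Level A r lo) (hlo : lo + 1 = r) (m s : ℕ) :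
    ((r : ℤ) - 1) * (m - 1) ≤ r * win A m s := by
  have hr : (1 : ℤ) ≤ r := by exact_mod_cast h.pos
  induction m using Nat.strong_induction_on generalizing s with
  | _ m ih =>
    rcases Nat.lt_or_ge m r with hlt | hge
    · obtain ⟨n, rfl⟩ := Nat.exists_eq_add_of_le hlt.le
      have h1 := win_add A m n s
      have h2 := (hA.win_bounds n (s + m)).2
      have h3 := (hA.win_bounds m s).1
      have h4 := h.two s
      push_cast at *
      rcases Nat.eq_zero_or_pos m with rfl | hm
      · rw [win_zero]
        push_cast
        linarith
      · have h5 : (m : ℤ) - 1 ≤ win A m s := by omega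
        nlinarith
    · obtain ⟨n, rfl⟩ := Nat.exists_eq_add_of_le hge
      have h1 := win_add A r n s
      have h2 := ih n (by have := h.pos; omega) (s + r)
      have h3 : (r : ℤ) - 1 ≤ win A r s := by have := h.two s; omega
      rw [h1]
      push_cast
      nlinarith

lemma mul_win_of_return (hA : FewReturns A) (h : Level A r lo) (hlo : lo + 1 = r) {i d : ℕ}
    (hret : IsReturn A r (lo + 1) i d) :
    r * win A d i = (r - 1) * d + 1 := by
  have hmid : ∀ k, 0 < k → k < d → win A r (i + k) = r - 1 := by
    intro k h1 h2
    have := h.two (i + k)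
    have := hret.2.2.2 k h1 h2
    omega
  have hfirst : ∀ k < r, win A 1 (i + k) = 1 :=
    fun k hk => hA.letter_of_win_eq (by rw [hret.2.1, hlo]) hk
  have key : ∀ m, r ≤ m → m < d → win A 1 (i + m) = 0 →
      r * win A (m + 1) i = (r - 1) * (m + 1) + 1 := by
    intro m
    induction m using Nat.strong_induction_on with
    | _ m ih =>
      intro hm hmd hz
      obtain ⟨n, rfl⟩ := Nat.exists_eq_add_of_le hm
      have hr := h.pos
      rcases Nat.eq_zero_or_pos n with rfl | hn
      · rw [add_zero] at hz
        rw [add_zero, win_add, hret.2.1, hz, hlo]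
        ring
      have h1 := hmid n hn (by omega)
      have h2 := hmid (n + 1) (by omega) (by omega)
      have h3 := win_succ A r (i + n)
      rw [add_assoc i n 1, h1, h2, show i + n + r = i + (r + n) by ring, hz] at h3
      have hnr : r ≤ n := by
        by_contra hlt
        have := hfirst n (by omega)
        omega
      have h4 := ih n (by omega) hnr (by omega) (by omega)
      rw [show r + n + 1 = n + 1 + r by ring, win_add, h2]
      push_cast
      linarith
  rcases eq_or_ne d 1 with rfl | hd1
  · have := hfirst 0 h.pos
    rw [add_zero] at this
    rw [this]
    push_cast
    ring
  · have hd := hret.1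
    obtain ⟨n, rfl⟩ : ∃ n, d = n + 1 := ⟨d - 1, by omega⟩
    have h1 := hmid n (by omega) (by omega)
    have h2 := hret.2.2.1
    have h3 := win_succ A r (i + n)
    rw [add_assoc i n 1, h2, h1, hlo] at h3
    have hz : win A 1 (i + n) = 0 := by
      have := hA.letter (i + n)
      have := hA.letter (i + n + r)
      omega
    have hnr : r ≤ n := by
      by_contra hlt
      have := hfirst n (by omega)
      omega
    have := key n hnr (by omega) hz
    push_cast
    exact this

/-- If the letter after the prefix changes from `1` to `0`, then some return does not satisfy the
identity of `mul_win_of_return`. -/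
lemma exists_long_return (hA : FewReturns A) (h : Level A r lo) (hlo : lo + 1 = r) {L b N q t : ℕ}
    (hb : IsPrefixAt A L b) (hb' : IsPrefixAt A L (b + N))
    (hz : win A 1 (b + N + L) = 0) (hrun : ∀ k < q, win A 1 (b + L + k) = 1)
    (hzero : win A 1 (L - r) = 0)
    (hones : ∀ k, L - r < k → k < L → win A 1 k = 1)
    (ht : win A r t = lo + 1) (htL : t + r ≤ L) :
    ∃ i d, IsReturn A (N + r) (win A N b + (lo + 1)) i d ∧
      (r - 1) * (d : ℤ) + 1 + q ≤ r * win A d i := by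
  have hr := h.pos
  have hfull : ∀ s k, win A r s = lo + 1 → k < r → win A 1 (s + k) = 1 :=
    fun s k hs hk => hA.letter_of_win_eq (by rw [hs, hlo]) hk
  obtain ⟨i, d, h1, h2, h3, hret⟩ := hA.exists_return_across (n := N + r) (i := b + t)
    (j := b + L) (by rw [hb.win_transport hb' htL, ht]) (by omega)
  obtain ⟨s, rfl⟩ := Nat.exists_eq_add_of_le ((Nat.le_add_right b t).trans h1)
  have hs : win A r (b + N + s) = lo + 1 := by
    have := hb.win_shift (r := r) hb' (k := s) (by omega)
    have := hret.2.1
    omega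
  have hsL : s + r ≤ L - r := by
    by_contra hlt
    rcases Nat.lt_or_ge (L - r) s with h4 | h4
    · have := hfull _ (L - s) hs (by omega)
      rw [show b + N + s + (L - s) = b + N + L by omega] at this
      omega
    · have := hfull _ (L - r - s) hs (by omega)
      rw [show b + N + s + (L - r - s) = b + N + (L - r) by omega, hb'.win_eq (by omega)] at this
      omega
  have hδ : ∀ k ≤ q, win A N (b + L + k) ≤ win A N b ∧
      (0 < k → win A N (b + L + k) < win A N b) := by
    intro k
    induction k with
    | zero =>
      intro _
      have e := hb.win_shift (r := 0) hb' le_rfl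
      simp only [add_zero, win_zero] at e
      simp [e]
    | succ k ih =>
      intro hk
      have e1 := win_succ A N (b + L + k)
      rw [hrun k (by omega), show b + L + k + N = b + N + L + k by ring] at e1
      have e2 := ih (by omega)
      have e3 := hA.letter (b + N + L + k)
      rw [← add_assoc]
      rcases Nat.eq_zero_or_pos k with rfl | hk0
      · rw [add_zero (b + N + L), hz] at e1
        omega
      · omega
  have hbelow : ∀ k ≤ q, win A (N + r) (b + L + k) ≠ win A N b + (lo + 1) := by
    intro k hk
    have e1 := win_add A N r (b + L + k)
    have e2 := hδ k hk
    rw [show b + L + k + N = b + N + L + k by ring] at e1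
    have e3 := h.two (b + N + L + k)
    rcases Nat.eq_zero_or_pos k with rfl | hk0
    · have : win A r (b + N + L + 0) ≠ lo + 1 := by
        intro e
        have := hfull _ 0 e hr
        simp only [add_zero] at this
        omega
      omega
    · omega
  have hlong : b + L + q + 1 ≤ b + s + d := by
    by_contra hlt
    refine hbelow (b + s + d - (b + L)) (by omega) ?_
    rw [Nat.add_sub_cancel' (by omega)]
    exact hret.2.2.1
  obtain ⟨m, hm⟩ := Nat.exists_eq_add_of_le hsL
  obtain ⟨n, hn⟩ := Nat.exists_eq_add_of_le hlong
  refine ⟨b + s, d, hret, ?_⟩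
  obtain rfl : d = r + (m + 1) + (r - 1 + q) + (n + 1) := by omega
  have e1 : win A r (b + s) = r := by
    rw [hb.win_eq (by omega), ← hb'.win_eq (by omega), hs, hlo]
  have e2 := h.le_mul_win hA hlo (m + 1) (b + s + r)
  have e3 : win A (r - 1 + q) (b + s + (r + (m + 1))) = (r - 1 + q : ℕ) := by
    refine win_of_ones fun k hk => ?_
    rcases Nat.lt_or_ge k (r - 1) with hlt | hge
    · rw [show b + s + (r + (m + 1)) + k = b + (L - r + 1 + k) by omega, hb.win_eq (by omega)]
      exact hones _ (by omega) (by omega)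
    · rw [show b + s + (r + (m + 1)) + k = b + L + (k - (r - 1)) by omega]
      exact hrun _ (by omega)
  have e4 := h.le_mul_win hA hlo (n + 1) (b + s + (r + (m + 1) + (r - 1 + q)))
  rw [win_add, win_add, win_add, e1, e3]
  push_cast [Nat.cast_sub (show 1 ≤ r from hr)] at *
  linarith

end Level

namespace Level

variable {A : ℕ → ℤ} {r : ℕ} {lo : ℤ}

lemma exists_low_return (hA : FewReturns A) (h : Level A r lo) :
    ∃ i d, 3 ≤ d ∧ IsReturn A r lo i d := by
  obtain ⟨t, ht, -, -⟩ := h.low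
  obtain ⟨s, hs, hs1, -⟩ := h.high
  obtain ⟨s', hts, hw⟩ := hA.recur s (r + 1) t
  have h0 := hw r (by omega)
  have h1 := hw (r + 1) le_rfl
  have h2 := hw 1 (by have := h.pos; omega)
  have e1 := win_add A 1 r s
  have e2 := win_add A 1 r s'
  rw [add_comm 1 r] at e1 e2
  obtain ⟨i, d, h3, h4, h5, hret⟩ := hA.exists_return_across ht hts
  refine ⟨i, d, ?_, hret⟩
  have hi : i ≠ s' := by
    rintro rfl
    have := hret.2.1
    omega
  have hd : i + d ≠ s' + 1 := by
    intro e
    have := hret.2.2.1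
    rw [e] at this
    omega
  omega

/-- Case where both one-letter returns occur for the lower sum, but not for the larger one. -/
lemma false_of_low_letters (hA : FewReturns A) (h : Level A r lo)
    (hb : ∀ t, win A r t = lo + 1 → win A 1 t = 1) (h11 : (1, 1) ∈ returnClasses A r lo) :
    False := by
  have huniq {i d i' d' : ℕ} (hr : IsReturn A r lo i d) (hr' : IsReturn A r lo i' d')
      (hd : 2 ≤ d) (hd' : 2 ≤ d') : d = d' :=
    congrArg Prod.fst (hA.eq_of_letters_mem h.mem_low h11 hr.mem hr'.mem hd hd')
  refine h.false_of_unique_returns hA ?_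
  rintro c (rfl | rfl) i d i' d' hr hr' hd hd'
  · exact huniq hr hr' hd hd'
  by_contra hne
  obtain ⟨u, q, hq3, hu⟩ := h.exists_low_return hA
  obtain ⟨q, rfl⟩ : ∃ p, q = p + 1 := ⟨q - 1, by omega⟩
  have hq : ∀ i d, IsReturn A r lo i d → 2 ≤ d → d = q + 1 :=
    fun i d hret hd => huniq hret hu hd (by omega)
  obtain ⟨t, ht, ht1, ht0⟩ := h.low
  obtain ⟨s, hs, hs1, hs0⟩ := h.high
  obtain ⟨v, hv, hv1⟩ := h11
  simp only at hv hv1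
  obtain ⟨L, hL, hspec⟩ := hA.exists_special
    (t + 1 + r + (s + 1 + r) + (v + 1 + r) + (u + (q + 1) + r) + (i + d + r) + (i' + d' + r))
  obtain ⟨a, -, ha, ha0⟩ := hspec 0 (.inl rfl) 0
  obtain ⟨b, hab, hb', hb1⟩ := hspec 1 (.inr rfl) a
  obtain ⟨N, rfl⟩ := Nat.exists_eq_add_of_le hab
  obtain ⟨a', hba, ha', ha0'⟩ := hspec 0 (.inl rfl) (a + N)
  obtain ⟨N', rfl⟩ := Nat.exists_eq_add_of_le hba
  replace ha : IsPrefixAt A L a := ha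
  replace hb' : IsPrefixAt A L (a + N) := hb'
  replace ha' : IsPrefixAt A L (a + N + N') := ha'
  have hcls : ∀ x ∈ returnClasses A (N + r) (win A N a + lo),
      x = (1, 0) ∨ x = (1, 1) ∨ x = (q + 1, (q : ℤ)) := by
    intro x hx
    have h0 := ha.mem_returnClasses hb' (isReturn_one ht ht1) (by omega)
    have h1 := ha.mem_returnClasses hb' hv (by omega)
    have h2 := ha.mem_returnClasses hb' hu (by omega)
    rw [ht0] at h0
    rw [← hv1] at h1
    rw [h.win_return hA hb hu (by omega)] at h2
    push_cast at h2
    rw [add_sub_cancel_right] at h2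
    by_contra! hx'
    refine encard_lt_four (hA.few (N + r) (win A N a + lo)) h0 h1 h2 hx (by simp) ?_
      hx'.1.symm ?_ hx'.2.1.symm hx'.2.2.symm <;>
    · rw [ne_eq, Prod.mk.injEq]
      omega
  have hrun := h.run_after hA hb ha hb' ha0 hb1 hq hcls ht (by omega)
  obtain ⟨hz, hones, hlo⟩ := h.run_before hA hb ha hb' ha0 (by omega) hq hrun ht (by omega)
  obtain ⟨j, e, hret, he⟩ := h.exists_long_return hA hlo hb' ha' ha0' hrun hz hones hs (by omega)
  have e1 := h.mul_win_of_return hA hlo (isReturn_one hs hs1)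
  have e2 := h.mul_win_of_return hA hlo hr
  have e3 := h.mul_win_of_return hA hlo hr'
  refine encard_lt_four (hA.few (N' + r) (win A N' (a + N) + (lo + 1)))
    (hb'.mem_returnClasses ha' (isReturn_one hs hs1) (by omega))
    (hb'.mem_returnClasses ha' hr (by omega)) (hb'.mem_returnClasses ha' hr' (by omega)) hret.mem
    ?_ ?_ ?_ ?_ ?_ ?_ <;> intro heq <;> rw [Prod.mk.injEq] at heq
  · omega
  · omega
  · obtain ⟨rfl, heq⟩ := heq
    rw [← heq] at he
    omega
  · omega
  · obtain ⟨rfl, heq⟩ := heq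
    rw [← heq] at he
    omega
  · obtain ⟨rfl, heq⟩ := heq
    rw [← heq] at he
    omega

lemma letter_of_high (hA : FewReturns A) (h : Level A r lo)
    (h1 : (1, 0) ∉ returnClasses A r (lo + 1)) {t : ℕ} (ht : win A r t = lo + 1) :
    win A 1 t = 1 := by
  refine (hA.letter t).resolve_left fun h0 => h1 ⟨t, isReturn_one ht ?_, h0.symm⟩
  have := win_succ A r t
  have := hA.letter (t + r)
  have := h.two (t + 1)
  omega

lemma letter_of_low (hA : FewReturns A) (h : Level A r lo)
    (h1 : (1, 1) ∉ returnClasses A r lo) {t : ℕ} (ht : win A r t = lo) :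
    win A 1 t = 0 := by
  refine (hA.letter t).resolve_right fun h0 => h1 ⟨t, isReturn_one ht ?_, h0.symm⟩
  have := win_succ A r t
  have := hA.letter (t + r)
  have := h.two (t + 1)
  omega

lemma elim (hA : FewReturns A) (h : Level A r lo) : False := by
  by_cases h0 : (1, 1) ∈ returnClasses A r lo <;>
    by_cases h1 : (1, 0) ∈ returnClasses A r (lo + 1)
  · exact h.false_of_letters hA h0 h1
  · exact h.false_of_low_letters hA (fun t ht => h.letter_of_high hA h1 ht) h0
  · have key : (r : ℤ) - (r - lo - 1) = lo + 1 := by ring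
    refine h.complement.false_of_low_letters hA.complement (fun t ht => ?_) ?_
    · rw [win_complement] at ht ⊢
      rw [h.letter_of_low hA h0 (by omega)]
      rfl
    · obtain ⟨i, hret, hw⟩ := h1
      refine ⟨i, isReturn_complement.mpr (by rwa [key]), ?_⟩
      simp only [win_complement] at hw ⊢
      rw [← hw]
      rfl
  · refine h.false_of_letter_eq hA fun t => ?_
    rcases h.two t with ht | ht
    · rw [h.letter_of_low hA h0 ht, ht, sub_self]
    · rw [h.letter_of_high hA h1 ht, ht, add_sub_cancel_left]

end Level

lemma length_factorAt (w : ℕ → α) (i n : ℕ) : (factorAt w i n).length = n := by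
  simp [factorAt]

lemma isFactor_factorAt (w : ℕ → α) (i n : ℕ) : IsFactor w (factorAt w i n) :=
  ⟨i, by rw [length_factorAt]⟩

/-- The number of ones among the first `t` letters of `w`. -/
def partialSum (w : ℕ → Bool) (t : ℕ) : ℤ := ((factorAt w 0 t).count true : ℤ)

lemma win_partialSum (w : ℕ → Bool) (n i : ℕ) :
    win (partialSum w) n i = ((factorAt w i n).count true : ℤ) := by
  rw [win, partialSum, partialSum, sub_eq_iff_eq_add', ← Nat.cast_add, ← List.count_append]
  simp [factorAt, List.range_add, Function.comp_def]

lemma win_one_partialSum (w : ℕ → Bool) (i : ℕ) :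
    win (partialSum w) 1 i = if w i then 1 else 0 := by
  rw [win_partialSum]
  cases h : w i <;> simp [factorAt, h]

lemma perm_iff_count_true {u v : List Bool} (h : u.length = v.length) :
    u.Perm v ↔ u.count true = v.count true := by
  refine ⟨fun hp => hp.count_eq _, fun ht => List.perm_iff_count.mpr fun a => ?_⟩
  have h1 := List.count_false_add_count_true u
  have h2 := List.count_false_add_count_true v
  cases a <;> omega

lemma mem_abelianOccurrences {w : ℕ → Bool} {i j n : ℕ} :
    j ∈ AbelianOccurrences w (factorAt w i n) ↔
      win (partialSum w) n j = win (partialSum w) n i := by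
  rw [AbelianOccurrences, Set.mem_ofPred_eq, length_factorAt,
    perm_iff_count_true (by simp [length_factorAt]), win_partialSum, win_partialSum, Nat.cast_inj]

lemma fewReturns_partialSum {w : ℕ → Bool} (hap : Aperiodic w) (hrec : Recurrent w)
    (h : ∀ u : List Bool, IsFactor w u → (abelianReturnClasses w u).encard ≤ 3) :
    FewReturns (partialSum w) where
  letter t := by
    rw [win_one_partialSum]
    split_ifs <;> simp
  recur i L N := by
    obtain ⟨i', hi', hf⟩ := hrec _ (isFactor_factorAt w i L) N
    refine ⟨i', hi', fun k hk => ?_⟩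
    rw [length_factorAt] at hf
    have key : ∀ j, (factorAt w j L).take k = factorAt w j k := fun j => by
      simp [factorAt, ← List.map_take, List.take_range, hk]
    rw [win_partialSum, win_partialSum, ← key, ← key, hf]
  aper T hT := by
    by_contra! hper
    refine hap ⟨T, hT, fun n => ?_⟩
    have := hper n
    rw [win_one_partialSum, win_one_partialSum] at this
    cases h1 : w (n + T) <;> cases h2 : w n <;> simp_all
  few n c := by
    by_cases hc : ∃ i, win (partialSum w) n i = c
    · obtain ⟨i, rfl⟩ := hc
      refine le_trans ?_ (h _ (isFactor_factorAt w i n))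
      refine (Set.encard_le_encard ?_).trans
        (Set.encard_image_le (fun m : Multiset Bool => (m.card, (m.count true : ℤ))) _)
      rintro ⟨d, x⟩ ⟨j, ⟨h0, h1, h2, h3⟩, hx⟩
      simp only at h0 h2 h3 hx
      refine ⟨_, ⟨factorAt w j d, ⟨j, j + d, mem_abelianOccurrences.mpr h1,
        mem_abelianOccurrences.mpr h2, by omega, fun k hk hk' hm => ?_, ?_⟩, rfl⟩, ?_⟩
      · refine h3 (k - j) (by omega) (by omega) ?_
        rw [Nat.add_sub_cancel' hk.le]
        exact mem_abelianOccurrences.mp hm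
      · rw [Nat.add_sub_cancel_left]
      · simp [length_factorAt, hx, win_partialSum]
    · rw [Set.eq_empty_of_forall_notMem (s := returnClasses (partialSum w) n c)]
      · simp
      · rintro ⟨d, x⟩ ⟨j, hret, -⟩
        exact hc ⟨j, hret.2.1⟩

/-- An unbalanced word has a shortest unbalanced pair. -/
lemma FewReturns.exists_level {A : ℕ → ℤ} (hA : FewReturns A)
    (h : ∃ n i j, win A n i + 1 < win A n j) : ∃ r lo, Level A r lo := by
  classical
  obtain ⟨i, j, hij⟩ := Nat.find_spec h
  have hbal : ∀ m < Nat.find h, ∀ i j, win A m i ≤ win A m j + 1 := fun m hm i j => by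
    have := Nat.find_min h hm
    push Not at this
    exact this j i
  have hn : 1 < Nat.find h := by
    by_contra hlt
    have h1 := (hA.win_bounds (Nat.find h) i).1
    have h2 := (hA.win_bounds (Nat.find h) j).2
    omega
  obtain ⟨r, hr⟩ : ∃ r, Nat.find h = r + 1 := ⟨Nat.find h - 1, by omega⟩
  rw [hr] at hij hbal hn
  have hR := hbal r (by omega)
  have e1 := win_add A r 1 i
  have e2 := win_add A r 1 j
  have e3 := win_succ A r i
  have e4 := win_succ A r j
  have := hA.letter i
  have := hA.letter j
  have := hA.letter (i + r)
  have := hA.letter (j + r)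
  have := hR j i
  have := hR (j + 1) (i + 1)
  have := hR j (i + 1)
  have := hR (j + 1) i
  refine ⟨r, win A r i, by omega, fun t => ?_, ⟨i, rfl, by omega, by omega⟩,
    ⟨j, by omega, by omega, by omega⟩, fun m hm => hbal m (by omega)⟩
  have := hR t i
  have := hR j t
  omega

/-- If each factor of an aperiodic recurrent infinite binary word `w` has
at most three abelian returns, then `w` is 2-balanced: any two factors of equal length have
numbers of ones differing by at most 2. -/
theorem two_balanced_of_at_most_three_abelian_returns
    (w : ℕ → Bool) (hap : Aperiodic w) (hrec : Recurrent w)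
    (h : ∀ u : List Bool, IsFactor w u → (abelianReturnClasses w u).encard ≤ 3) :
    ∀ u v : List Bool, IsFactor w u → IsFactor w v → u.length = v.length →
      |(u.count true : ℤ) - (v.count true : ℤ)| ≤ 2 := by
  have hA := fewReturns_partialSum hap hrec h
  rintro u v ⟨i, hi⟩ ⟨j, hj⟩ huv
  have hbal : ∀ n i j, win (partialSum w) n j ≤ win (partialSum w) n i + 1 := by
    by_contra! hex
    obtain ⟨r, lo, hL⟩ := hA.exists_level hex
    exact hL.elim hA
  have h1 := hbal u.length i j
  have h2 := hbal u.length j i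
  rw [win_partialSum, win_partialSum, hi, huv, hj] at h1 h2
  rw [abs_le]
  omega
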